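/- Let k be a field of characteristic 5 and K = k(x,y). Then the derivation ∂ = y·∂_x + x²·∂_y of K is 5-closed; that is, there exists a ∈ K with ∂⁵ = a·∂, where ∂⁵ denotes the 5-fold iterate of ∂. -/

import Mathlib

open MvPolynomial

noncomputable section

/-- The rational function field `k(x,y)`, realized as the fraction field of `k[x,y]`. -/
abbrev RatFld2 (k : Type) [Field k] : Type := FractionRing (MvPolynomial (Fin 2) k)

/-- The image of the indeterminate `x` in `k(x,y)`. -/
abbrev xK (k : Type) [Field k] : RatFld2 k :=
  algebraMap (MvPolynomial (Fin 2) k) (RatFld2 k) (X 0)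

/-- The image of the indeterminate `y` in `k(x,y)`. -/
abbrev yK (k : Type) [Field k] : RatFld2 k :=
  algebraMap (MvPolynomial (Fin 2) k) (RatFld2 k) (X 1)

/-- In characteristic `5`, the fifth iterate of a derivation is a derivation. -/
def Derivation.iterateFive {R A : Type*} [CommRing R] [CommRing A] [Algebra R A] [CharP A 5]
    (D : Derivation R A A) : Derivation R A A :=
  Derivation.mk' ((D : A →ₗ[R] A) ^ 5) fun a b => by
    have h5 : (5 : A) = 0 := by exact_mod_cast CharP.cast_eq_zero A 5
    simp only [Module.End.pow_apply, Function.iterate_succ, Function.iterate_zero,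
      Function.comp_apply, id_eq, Derivation.coeFn_coe, Derivation.leibniz, map_add,
      smul_eq_mul]
    linear_combination
      (D a * D (D (D (D b))) + 2 * D (D a) * D (D (D b)) + 2 * D (D (D a)) * D (D b)
        + D (D (D (D a))) * D b) * h5

/-- A derivation of `k(x,y)` vanishing on both indeterminates is zero. -/
theorem derivation_ratFld2_eq_zero {k : Type} [Field k]
    {D : Derivation k (RatFld2 k) (RatFld2 k)} (hx : D (xK k) = 0) (hy : D (yK k) = 0)
    (z : RatFld2 k) : D z = 0 := by
  have hpoly : D.compAlgebraMap (MvPolynomial (Fin 2) k) = 0 := by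
    refine MvPolynomial.derivation_ext fun i => ?_
    fin_cases i
    · exact hx
    · exact hy
  have hmap (p : MvPolynomial (Fin 2) k) : D (algebraMap _ (RatFld2 k) p) = 0 :=
    DFunLike.congr_fun hpoly p
  obtain ⟨p, q, hq, rfl⟩ := IsFractionRing.div_surjective (A := MvPolynomial (Fin 2) k) z
  rw [Derivation.leibniz_div, hmap, hmap]
  simp

/-- Final example of the paper: over a field `k` of characteristic `5`, the derivation
`∂ = y·∂_x + x²·∂_y` of `K = k(x,y)` is `5`-closed: there is `a ∈ K` with `∂⁵ = a·∂`. -/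
theorem example_char_five_p_closed
    (k : Type) [Field k] [CharP k 5]
    (Dx Dy : Derivation k (RatFld2 k) (RatFld2 k))
    (hDxx : Dx (xK k) = 1) (hDxy : Dx (yK k) = 0)
    (hDyx : Dy (xK k) = 0) (hDyy : Dy (yK k) = 1) :
    ∃ a : RatFld2 k, ∀ z,
      (⇑(yK k • Dx + (xK k ^ 2) • Dy))^[5] z
        = a * (yK k • Dx + (xK k ^ 2) • Dy) z := by
  have : CharP (RatFld2 k) 5 := charP_of_injective_algebraMap (algebraMap k (RatFld2 k)).injective 5
  set D := yK k • Dx + (xK k ^ 2) • Dy with hD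
  have h5 : (5 : RatFld2 k) = 0 := by exact_mod_cast CharP.cast_eq_zero (RatFld2 k) 5
  have hx : D (xK k) = yK k := by simp [hD, hDxx, hDyx, Algebra.smul_def]
  have hy : D (yK k) = xK k ^ 2 := by simp [hD, hDxy, hDyy]
  have hx4 : D (D (D (D (xK k)))) = 2 * yK k ^ 2 + 2 * xK k ^ 3 := by
    rw [hx, hy, pow_two, D.leibniz, hx, map_add, smul_eq_mul, D.leibniz, hx, hy]
    simp only [smul_eq_mul]
    ring
  have hx5 : D (D (D (D (D (xK k))))) = 0 := by
    have h2 : D (2 : RatFld2 k) = 0 := by exact_mod_cast D.map_natCast 2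
    rw [hx4]
    simp only [map_add, D.leibniz, D.leibniz_pow, hx, hy, h2, smul_eq_mul, nsmul_eq_mul]
    push_cast
    linear_combination 2 * yK k * xK k ^ 2 * h5
  have hy5 : D (D (D (D (D (yK k))))) = 0 := by
    rw [← hx, hx5, map_zero]
  refine ⟨0, fun z => ?_⟩
  rw [zero_mul]
  exact derivation_ratFld2_eq_zero (D := D.iterateFive) hx5 hy5 z
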